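/- arXiv:1811.02702 — 8 statements merged into one kernel-verified Lean document; each statement's English description precedes it below -/
import Mathlib

section
/- Let K be an n×n real positive semidefinite matrix, let w, s, o ∈ ℝⁿ, and set d = s − w. Assume (s − w)ᵀK(o − w) ≥ (o − w)ᵀK(o − w) (i.e., s attains at least the value of the candidate o in the linear maximization defining the Frank–Wolfe direction) and dᵀKd > 0. Then the exact line-search step size γ = dᵀK(o − w) / (dᵀKd) satisfies 0 ≤ γ ≤ 1. -/
open Matrix

/-- Step-size lemma for Frank–Wolfe Sparse Representation: the exact line-search
step size lies in `[0, 1]`. -/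
theorem fwsr_step_size_in_unit_interval {n : ℕ}
    (K : Matrix (Fin n) (Fin n) ℝ) (hK : K.PosSemidef)
    (w s o : Fin n → ℝ) (d : Fin n → ℝ) (hd : d = s - w)
    (hmax : (s - w) ⬝ᵥ K.mulVec (o - w) ≥ (o - w) ⬝ᵥ K.mulVec (o - w))
    (hpos : 0 < d ⬝ᵥ K.mulVec d) :
    0 ≤ d ⬝ᵥ K.mulVec (o - w) / (d ⬝ᵥ K.mulVec d) ∧
      d ⬝ᵥ K.mulVec (o - w) / (d ⬝ᵥ K.mulVec d) ≤ 1 := by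
  subst hd
  have hnonneg (x : Fin n → ℝ) : 0 ≤ x ⬝ᵥ K *ᵥ x := by
    simpa using hK.dotProduct_mulVec_nonneg x
  have hsymm (x y : Fin n → ℝ) : x ⬝ᵥ K *ᵥ y = y ⬝ᵥ K *ᵥ x := by
    have hT : Kᵀ = K := by simpa using hK.isHermitian.eq
    rw [dotProduct_mulVec, ← mulVec_transpose, hT, dotProduct_comm]
  generalize s - w = d at *
  generalize o - w = e at *
  have he := hnonneg e
  have hdiff := hnonneg (d - e)
  simp only [mulVec_sub, dotProduct_sub, sub_dotProduct, hsymm e d] at hdiff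
  exact ⟨div_nonneg (by linarith) hpos.le, (div_le_one hpos).2 (by linarith)⟩
end

section
/- Let B be an m×N real matrix, let w, s, o ∈ ℝᴺ, set d = s − w and K = BᵀB. Assume Bd ≠ 0 and Bw ≠ Bo, and let γ* = dᵀK(o − w) / (dᵀKd). Then ‖B(w + γ*d) − Bo‖₂² = ‖Bw − Bo‖₂² · (1 − c²), where c = ⟨Bs − Bw, Bo − Bw⟩ / (‖Bs − Bw‖₂ · ‖Bo − Bw‖₂) is the cosine of the angle between Bs − Bw and Bo − Bw. -/
open Matrix

/-- Euclidean norm of a vector in `ℝⁿ`, written via the dot product. -/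
noncomputable def euclNorm {m : ℕ} (v : Fin m → ℝ) : ℝ := Real.sqrt (v ⬝ᵥ v)

theorem euclNorm_sq {m : ℕ} (v : Fin m → ℝ) : euclNorm v ^ 2 = v ⬝ᵥ v :=
  Real.sq_sqrt (Finset.sum_nonneg fun i _ => mul_self_nonneg (v i))

theorem dotProduct_transpose_mul_self_mulVec {m N : ℕ} (B : Matrix (Fin m) (Fin N) ℝ)
    (x y : Fin N → ℝ) : x ⬝ᵥ (Bᵀ * B).mulVec y = B.mulVec x ⬝ᵥ B.mulVec y := by
  rw [← mulVec_mulVec, dotProduct_mulVec, vecMul_transpose]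

/-- The squared distance from `r` to the line spanned by `u`, in terms of the cosine of the
angle between `u` and `r`. -/
theorem dotProduct_self_projection_sub {m : ℕ} {u r : Fin m → ℝ} (hu : u ≠ 0) (hr : r ≠ 0) :
    ((u ⬝ᵥ r / (u ⬝ᵥ u)) • u - r) ⬝ᵥ ((u ⬝ᵥ r / (u ⬝ᵥ u)) • u - r)
      = (r ⬝ᵥ r) * (1 - (u ⬝ᵥ r / (euclNorm u * euclNorm r)) ^ 2) := by
  have huu : u ⬝ᵥ u ≠ 0 := dotProduct_self_eq_zero.not.mpr hu
  have hrr : r ⬝ᵥ r ≠ 0 := dotProduct_self_eq_zero.not.mpr hr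
  rw [div_pow, mul_pow, euclNorm_sq, euclNorm_sq]
  simp only [sub_dotProduct, dotProduct_sub, smul_dotProduct, dotProduct_smul, smul_eq_mul,
    dotProduct_comm r u]
  field_simp
  ring

/-- Per-iteration contraction identity for exact line search on the quadratic
objective `f(w) = ‖Bw − Bo‖₂²` along the Frank–Wolfe direction `d = s − w`:
the new objective value equals the old one times `(1 − c²)`, where `c` is the
cosine of the angle between `Bs − Bw` and `Bo − Bw`. -/
theorem fwsr_contraction_identity {m N : ℕ}
    (B : Matrix (Fin m) (Fin N) ℝ) (w s o : Fin N → ℝ)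
    (d : Fin N → ℝ) (hd : d = s - w)
    (K : Matrix (Fin N) (Fin N) ℝ) (hK : K = Bᵀ * B)
    (hBd : B.mulVec d ≠ 0) (hBwo : B.mulVec w ≠ B.mulVec o)
    (γstar : ℝ) (hγ : γstar = d ⬝ᵥ K.mulVec (o - w) / (d ⬝ᵥ K.mulVec d))
    (c : ℝ)
    (hc : c = (B.mulVec s - B.mulVec w) ⬝ᵥ (B.mulVec o - B.mulVec w) /
        (euclNorm (B.mulVec s - B.mulVec w) * euclNorm (B.mulVec o - B.mulVec w))) :
    (B.mulVec (w + γstar • d) - B.mulVec o) ⬝ᵥ (B.mulVec (w + γstar • d) - B.mulVec o)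
      = ((B.mulVec w - B.mulVec o) ⬝ᵥ (B.mulVec w - B.mulVec o)) * (1 - c ^ 2) := by
  have hu : B.mulVec s - B.mulVec w = B.mulVec d := by rw [hd, mulVec_sub]
  have hr : B.mulVec o - B.mulVec w ≠ 0 := sub_ne_zero.mpr hBwo.symm
  have hnew : B.mulVec (w + γstar • d) - B.mulVec o
      = γstar • B.mulVec d - (B.mulVec o - B.mulVec w) := by
    rw [mulVec_add, mulVec_smul]; abel
  have hγ' : γstar = B.mulVec d ⬝ᵥ (B.mulVec o - B.mulVec w) /
      (B.mulVec d ⬝ᵥ B.mulVec d) := by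
    rw [hγ, hK, dotProduct_transpose_mul_self_mulVec, dotProduct_transpose_mul_self_mulVec,
      mulVec_sub]
  rw [hu] at hc
  rw [hnew, hγ', dotProduct_self_projection_sub hBd hr, ← hc,
    ← neg_sub (B.mulVec o) (B.mulVec w), neg_dotProduct_neg]
end

section
/- Let A be a d×n real matrix and let β > n. Let M_{2,β} = {X ∈ ℝ^{n×n} : Σ_{i=1}^{n} ‖X^{(i)}‖₂ ≤ β} be the 2-norm group lasso ball of radius β, where X^{(i)} denotes the i-th row of X. Then there exists r > 0 such that for every X ∈ M_{2,β} with AX ≠ A, the matrix AX + (‖A − AX‖_F + r)·(A − AX)/‖A − AX‖_F belongs to {AY : Y ∈ M_{2,β}}, where ‖·‖_F denotes the Frobenius norm. -/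
open Matrix

/-- Euclidean norm of the `i`-th row of a matrix. -/
noncomputable def rowNorm {n m : ℕ} (X : Matrix (Fin n) (Fin m) ℝ) (i : Fin n) : ℝ :=
  Real.sqrt (∑ j, (X i j) ^ 2)

/-- The 2-norm group lasso ball of radius `β`. -/
def glBall (n : ℕ) (β : ℝ) : Set (Matrix (Fin n) (Fin n) ℝ) :=
  {X | ∑ i, rowNorm X i ≤ β}

/-- Frobenius norm of a matrix. -/
noncomputable def frobNorm {d n : ℕ} (M : Matrix (Fin d) (Fin n) ℝ) : ℝ :=
  Real.sqrt (∑ i, ∑ j, (M i j) ^ 2)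

theorem rowNorm_eq_norm {n m : ℕ} (X : Matrix (Fin n) (Fin m) ℝ) (i : Fin n) :
    rowNorm X i = ‖WithLp.toLp 2 (X i)‖ := by
  simp [rowNorm, EuclideanSpace.norm_eq]

theorem rowNorm_add_le {n m : ℕ} (X Y : Matrix (Fin n) (Fin m) ℝ) (i : Fin n) :
    rowNorm (X + Y) i ≤ rowNorm X i + rowNorm Y i := by
  simp only [rowNorm_eq_norm]
  exact norm_add_le (WithLp.toLp 2 (X i)) (WithLp.toLp 2 (Y i))

theorem rowNorm_smul {n m : ℕ} (c : ℝ) (X : Matrix (Fin n) (Fin m) ℝ) (i : Fin n) :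
    rowNorm (c • X) i = |c| * rowNorm X i := by
  simp only [rowNorm_eq_norm]
  exact norm_smul c (WithLp.toLp 2 (X i))

theorem rowNorm_one {n : ℕ} (i : Fin n) : rowNorm (1 : Matrix (Fin n) (Fin n) ℝ) i = 1 := by
  simp [rowNorm, Matrix.one_apply]

theorem rowNorm_mul_le {n d m : ℕ} (G : Matrix (Fin n) (Fin d) ℝ) (R : Matrix (Fin d) (Fin m) ℝ)
    (i : Fin n) : rowNorm (G * R) i ≤ rowNorm G i * frobNorm R := by
  unfold rowNorm frobNorm
  rw [← Real.sqrt_mul (Finset.sum_nonneg fun _ _ => sq_nonneg _)]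
  apply Real.sqrt_le_sqrt
  rw [Finset.sum_comm (f := fun i j => R i j ^ 2), Finset.mul_sum]
  refine Finset.sum_le_sum fun j _ => ?_
  rw [Matrix.mul_apply]
  exact Finset.sum_mul_sq_le_sq_mul_sq _ _ _

theorem frobNorm_pos {d n : ℕ} {M : Matrix (Fin d) (Fin n) ℝ} (hM : M ≠ 0) : 0 < frobNorm M := by
  refine Real.sqrt_pos.2 ?_
  have hnn : ∀ i, 0 ≤ ∑ j, M i j ^ 2 := fun i => Finset.sum_nonneg fun _ _ => sq_nonneg _
  refine lt_of_le_of_ne (Finset.sum_nonneg fun i _ => hnn i) fun h => hM ?_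
  ext i j
  have hi := (Finset.sum_eq_zero_iff_of_nonneg fun i _ => hnn i).1 h.symm i (Finset.mem_univ i)
  have hij := (Finset.sum_eq_zero_iff_of_nonneg fun _ _ => sq_nonneg _).1 hi j (Finset.mem_univ j)
  simpa using hij

/-- Every matrix over a field has a generalized inverse. -/
theorem Matrix.exists_mul_mul_eq_self {K : Type*} [Field K] {d n : ℕ}
    (A : Matrix (Fin d) (Fin n) K) : ∃ G : Matrix (Fin n) (Fin d) K, A * G * A = A := by
  obtain ⟨h, hh⟩ := A.toLin'.rangeRestrict.exists_rightInverse_of_surjective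
    A.toLin'.range_rangeRestrict
  obtain ⟨g, hg⟩ := h.exists_extend
  refine ⟨LinearMap.toMatrix' g, Matrix.toLin'.injective (LinearMap.ext fun v => ?_)⟩
  have hgv : g (A.toLin' v) = h (A.toLin'.rangeRestrict v) :=
    LinearMap.congr_fun hg (A.toLin'.rangeRestrict v)
  have hhv := congrArg Subtype.val (LinearMap.congr_fun hh (A.toLin'.rangeRestrict v))
  rw [Matrix.toLin'_mul, Matrix.toLin'_mul, Matrix.toLin'_toMatrix']
  simp only [LinearMap.comp_apply, hgv]
  exact hhv

/-- For `β > n`, there is an `r > 0` such that for every `X` in the group lasso ball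
with `AX ≠ A`, the residual direction extended past `A` by distance `r`,
`AX + (‖A − AX‖_F + r)·(A − AX)/‖A − AX‖_F`, still lies in the image `{AY : Y ∈ M_{2,β}}`. -/
theorem extended_residual_in_image {d n : ℕ}
    (A : Matrix (Fin d) (Fin n) ℝ) (β : ℝ) (hβ : (n : ℝ) < β) :
    ∃ r > 0, ∀ X ∈ glBall n β, A * X ≠ A →
      ∃ Y ∈ glBall n β,
        A * X + (frobNorm (A - A * X) + r) • ((frobNorm (A - A * X))⁻¹ • (A - A * X))
          = A * Y := by
  obtain ⟨G, hG⟩ := A.exists_mul_mul_eq_self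
  have hC : 0 ≤ ∑ i, rowNorm G i := Finset.sum_nonneg fun _ _ => Real.sqrt_nonneg _
  have hr : 0 < (β - n) / (∑ i, rowNorm G i + 1) := div_pos (sub_pos.2 hβ) (by linarith)
  have hrC : (β - n) / (∑ i, rowNorm G i + 1) * (∑ i, rowNorm G i) ≤ β - n := by
    rw [div_mul_eq_mul_div, div_le_iff₀ (by linarith)]
    nlinarith
  generalize (β - n) / (∑ i, rowNorm G i + 1) = r at hr hrC
  refine ⟨r, hr, fun X _ hX => ?_⟩
  have hF : 0 < frobNorm (A - A * X) := frobNorm_pos (sub_ne_zero.2 hX.symm)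
  have hAG : A * (G * (A - A * X)) = A - A * X := by
    rw [← Matrix.mul_assoc, Matrix.mul_sub, ← Matrix.mul_assoc, hG]
  generalize hR : A - A * X = R at hF hAG
  refine ⟨1 + (r * (frobNorm R)⁻¹) • (G * R), ?_, ?_⟩
  · have hrow (i : Fin n) :
        rowNorm (1 + (r * (frobNorm R)⁻¹) • (G * R)) i ≤ 1 + r * rowNorm G i := by
      refine (rowNorm_add_le _ _ i).trans ?_
      rw [rowNorm_one, rowNorm_smul, abs_of_pos (by positivity)]
      have hle := mul_le_mul_of_nonneg_left (rowNorm_mul_le G R i)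
        (show 0 ≤ r * (frobNorm R)⁻¹ by positivity)
      have heq : r * (frobNorm R)⁻¹ * (rowNorm G i * frobNorm R) = r * rowNorm G i := by
        field_simp
      linarith
    refine (Finset.sum_le_sum fun i _ => hrow i).trans ?_
    rw [Finset.sum_add_distrib, ← Finset.mul_sum]
    simp only [Finset.sum_const, Finset.card_univ, Fintype.card_fin, nsmul_eq_mul, mul_one]
    linarith
  · rw [Matrix.mul_add, Matrix.mul_one, Matrix.mul_smul, hAG, add_smul, smul_smul, smul_smul,
      mul_inv_cancel₀ hF.ne', one_smul, ← add_assoc, ← hR, add_sub_cancel]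
end

section
/- Let α ∈ (0,1] and x₀ ∈ [0,1], and let the sequence (x_n) satisfy the logistic recursion x_{n+1} = α·x_n·(1 − x_n) for all n ≥ 0. Then for every n ∈ ℕ, x_n ≤ x₀ / (α^{−n} + x₀·n). -/
lemma logistic_mem_Icc {α : ℝ} (hα : α ∈ Set.Ioc (0 : ℝ) 1) {x : ℝ}
    (hx : x ∈ Set.Icc (0 : ℝ) 1) : α * x * (1 - x) ∈ Set.Icc (0 : ℝ) 1 := by
  obtain ⟨hα0, hα1⟩ := hα
  obtain ⟨hx0, hx1⟩ := hx
  have hαx : 0 ≤ α * x := mul_nonneg hα0.le hx0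
  exact ⟨mul_nonneg hαx (sub_nonneg.2 hx1),
    mul_le_one₀ (mul_le_one₀ hα1 hx0 hx1) (sub_nonneg.2 hx1) (by linarith)⟩

/-- Logistic recursion lemma (Lemma A.6 of Campbell–Broderick): if
`x_{n+1} = α·x_n·(1 − x_n)` with `α ∈ (0,1]` and `x₀ ∈ [0,1]`, then
`x_n ≤ x₀ / (α^{−n} + x₀·n)` for all `n`. -/
theorem logistic_recursion_bound (α : ℝ) (hα : α ∈ Set.Ioc (0 : ℝ) 1)
    (x : ℕ → ℝ) (hx0 : x 0 ∈ Set.Icc (0 : ℝ) 1)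
    (hrec : ∀ n : ℕ, x (n + 1) = α * x n * (1 - x n)) :
    ∀ n : ℕ, x n ≤ x 0 / (α ^ (-(n : ℤ)) + x 0 * n) := by
  have hmem : ∀ n, x n ∈ Set.Icc (0 : ℝ) 1 := by
    intro n
    induction n with
    | zero => exact hx0
    | succ n ih => exact hrec n ▸ logistic_mem_Icc hα ih
  obtain ⟨hα0, hα1⟩ := hα
  intro n
  rw [le_div_iff₀ (add_pos_of_pos_of_nonneg (zpow_pos hα0 _)
    (mul_nonneg hx0.1 n.cast_nonneg))]
  induction n with
  | zero => simp
  | succ n ih =>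
    obtain ⟨hn0, hn1⟩ := hmem n
    have hpow : α * α ^ (-((n + 1 : ℕ) : ℤ)) = α ^ (-(n : ℤ)) := by
      rw [← zpow_one_add₀ hα0.ne']
      congr 1
      push_cast
      ring
    have hlin : α * (x 0 * (n + 1)) ≤ x 0 * (n + 1) :=
      mul_le_of_le_one_left (mul_nonneg hx0.1 (by positivity)) hα1
    have hnonneg : 0 ≤ x n * (1 - x n) := mul_nonneg hn0 (sub_nonneg.2 hn1)
    calc x (n + 1) * (α ^ (-((n + 1 : ℕ) : ℤ)) + x 0 * (n + 1 : ℕ))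
        = x n * (1 - x n) * (α * α ^ (-((n + 1 : ℕ) : ℤ)) + α * (x 0 * (n + 1))) := by
          rw [hrec]
          push_cast
          ring
      _ ≤ x n * (1 - x n) * (α ^ (-(n : ℤ)) + x 0 * (n + 1)) := by
          rw [hpow]
          gcongr
      _ = (1 - x n) * (x n * (α ^ (-(n : ℤ)) + x 0 * n) + x n * x 0) := by ring
      _ ≤ (1 - x n) * (x 0 + x n * x 0) :=
          mul_le_mul_of_nonneg_left (by linarith) (sub_nonneg.2 hn1)
      _ ≤ x 0 := by nlinarith [mul_nonneg hx0.1 (sq_nonneg (x n))]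
end

section
/- Let ν ∈ (0,1] and C > 0 with C·ν ≥ 1, and let (x_t) be a sequence with 0 ≤ x_t ≤ 1 for all t, satisfying x_{t+1} ≤ ν²·x_t·(1 − x_t) for all t ≥ 0 and x₀ ≤ 1/(C²ν²). Then for every t ∈ ℕ, x_t ≤ 1 / (C²·ν^{2−2t} + t). -/
/-- One step of the damped logistic recursion: a bound `x ≤ 1 / d` improves to `1 / d'` for every
`d'` with `q * d' ≤ d + 1`. -/
theorem logistic_step_mul_le_one {q x y d d' : ℝ} (hx : x ∈ Set.Icc (0 : ℝ) 1) (hd' : 0 ≤ d')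
    (hy : y ≤ q * x * (1 - x)) (hxd : x * d ≤ 1) (hdd' : q * d' ≤ d + 1) : y * d' ≤ 1 := by
  have hx1 : 0 ≤ 1 - x := sub_nonneg.2 hx.2
  calc y * d' ≤ q * x * (1 - x) * d' := mul_le_mul_of_nonneg_right hy hd'
    _ = x * (1 - x) * (q * d') := by ring
    _ ≤ x * (1 - x) * (d + 1) := mul_le_mul_of_nonneg_left hdd' (mul_nonneg hx.1 hx1)
    _ = (1 - x) * (x * d + x) := by ring
    _ ≤ (1 - x) * (1 + x) := by gcongr
    _ ≤ 1 := by nlinarith [sq_nonneg x]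

/-- Recursion-to-rate argument for FWSR: if `x_{t+1} ≤ ν²·x_t·(1 − x_t)` with
`x_t ∈ [0,1]`, `ν ∈ (0,1]`, `C > 0`, `Cν ≥ 1` and `x₀ ≤ 1/(C²ν²)`, then
`x_t ≤ 1/(C²·ν^{2−2t} + t)` for all `t`. -/
theorem damped_logistic_rate (ν C : ℝ) (hν : ν ∈ Set.Ioc (0 : ℝ) 1)
    (hC : 0 < C) (hCν : 1 ≤ C * ν)
    (x : ℕ → ℝ) (hx : ∀ t : ℕ, x t ∈ Set.Icc (0 : ℝ) 1)
    (hrec : ∀ t : ℕ, x (t + 1) ≤ ν ^ 2 * x t * (1 - x t))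
    (hx0 : x 0 ≤ 1 / (C ^ 2 * ν ^ 2)) :
    ∀ t : ℕ, x t ≤ 1 / (C ^ 2 * ν ^ (2 - 2 * (t : ℤ)) + t) := by
  obtain ⟨hν0, hν1⟩ := hν
  have hpos (t : ℕ) : 0 < C ^ 2 * ν ^ (2 - 2 * (t : ℤ)) + t := by positivity
  intro t
  rw [le_div_iff₀ (hpos t)]
  induction t with
  | zero =>
    rw [le_div_iff₀ (by positivity)] at hx0
    simpa using hx0
  | succ t ih =>
    refine logistic_step_mul_le_one (hx t) (hpos (t + 1)).le (hrec t) ih ?_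
    have hpow : ν ^ 2 * ν ^ (2 - 2 * ((t + 1 : ℕ) : ℤ)) = ν ^ (2 - 2 * (t : ℤ)) := by
      rw [← zpow_natCast ν 2, ← zpow_add₀ hν0.ne']
      congr 1
      push_cast
      ring
    have hν2 : ν ^ 2 * ((t : ℝ) + 1) ≤ t + 1 :=
      mul_le_of_le_one_left (by positivity) (pow_le_one₀ hν0.le hν1)
    rw [mul_add, mul_left_comm, hpow]
    push_cast
    linarith
end

section
/- Let λ > 0, β > 0, C > 0 and ν ∈ (0,1] with C·ν ≥ 1, and let (f_t) be a sequence of nonnegative reals satisfying f₀ ≤ 4β²λ and f_{t+1} ≤ f_t·(ν² − f_t/(4β²C²λ)) for all t ≥ 0. Then for every t ∈ ℕ, f_t ≤ 4β²C²λν² / (C²·ν^{2−2t} + t). In particular, f_t ≤ 4β²λ·ν^{2t} for every t, so the sequence converges to 0 at a linear (geometric) rate. -/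
/-- One step of the recursion `g' ≤ g (q - g)`: if `g ≤ q / (q P + t)`, then
`g' ≤ q / (P + (t + 1))`. -/
lemma mul_add_succ_le_of_le_mul_sub {g g' q P t : ℝ} (hq : 0 < q) (hq1 : q ≤ 1)
    (hP : 0 < P) (ht : 0 ≤ t) (hg : 0 ≤ g) (hgt : g * (q * P + t) ≤ q)
    (hg' : g' ≤ g * (q - g)) : g' * (P + (t + 1)) ≤ q := by
  rcases le_total q g with h | h
  · have : g' ≤ 0 := hg'.trans (mul_nonpos_of_nonneg_of_nonpos hg (by linarith))
    nlinarith [mul_nonneg (neg_nonneg.2 this) (by linarith : 0 ≤ P + (t + 1))]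
  · have hqg : 0 ≤ q - g := by linarith
    refine le_of_mul_le_mul_left ?_ hq
    calc q * (g' * (P + (t + 1)))
        ≤ q * (g * (q - g) * (P + (t + 1))) := by gcongr
      _ = (q - g) * (g * (q * P + q * (t + 1))) := by ring
      _ ≤ (q - g) * (g * (q * P + 1 * (t + 1))) := by gcongr
      _ = (q - g) * (g * (q * P + t) + g) := by ring
      _ ≤ (q - g) * (q + g) := by gcongr
      _ ≤ q * q := by nlinarith [sq_nonneg g]

/-- Linear convergence of Frank–Wolfe Sparse Representation, stated for the
sequence of objective values `f_t = ‖AX_t − A‖_F²`: from the per-iteration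
inequality `f_{t+1} ≤ f_t·(ν² − f_t/(4β²C²λ))` and `f₀ ≤ 4β²λ` one gets
`f_t ≤ 4β²C²λν²/(C²ν^{2−2t} + t)`, and in particular `f_t ≤ 4β²λ·ν^{2t}`,
a linear (geometric) convergence rate. -/
theorem fwsr_linear_convergence (lam β C ν : ℝ)
    (hlam : 0 < lam) (hβ : 0 < β) (hC : 0 < C)
    (hν : ν ∈ Set.Ioc (0 : ℝ) 1) (hCν : 1 ≤ C * ν)
    (f : ℕ → ℝ) (hf : ∀ t : ℕ, 0 ≤ f t)
    (hf0 : f 0 ≤ 4 * β ^ 2 * lam)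
    (hrec : ∀ t : ℕ, f (t + 1) ≤ f t * (ν ^ 2 - f t / (4 * β ^ 2 * C ^ 2 * lam))) :
    ∀ t : ℕ,
      f t ≤ 4 * β ^ 2 * C ^ 2 * lam * ν ^ 2 / (C ^ 2 * ν ^ (2 - 2 * (t : ℤ)) + t) ∧
      f t ≤ 4 * β ^ 2 * lam * ν ^ (2 * t) := by
  obtain ⟨hν0, hν1⟩ := hν
  have hM : 0 < 4 * β ^ 2 * C ^ 2 * lam := by positivity
  have hP : ∀ t : ℕ, 0 < C ^ 2 * ν ^ (2 - 2 * (t : ℤ)) := fun t => by positivity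
  have key : ∀ t : ℕ, f t / (4 * β ^ 2 * C ^ 2 * lam) *
      (C ^ 2 * ν ^ (2 - 2 * (t : ℤ)) + t) ≤ ν ^ 2 := by
    intro t
    induction t with
    | zero =>
      have h : f 0 / (4 * β ^ 2 * C ^ 2 * lam) * C ^ 2 ≤ 1 := by
        rw [div_mul_eq_mul_div, div_le_one hM]
        nlinarith [mul_le_mul_of_nonneg_right hf0 (sq_nonneg C)]
      have h2 : ν ^ (2 - 2 * ((0 : ℕ) : ℤ)) = ν ^ 2 := by norm_cast
      rw [h2, Nat.cast_zero, add_zero, ← mul_assoc]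
      exact mul_le_of_le_one_left (sq_nonneg ν) h
    | succ t ih =>
      have hstep : ν ^ (2 - 2 * (t : ℤ)) = ν ^ 2 * ν ^ (2 - 2 * ((t + 1 : ℕ) : ℤ)) := by
        rw [← zpow_natCast, ← zpow_add₀ hν0.ne']
        congr 1
        push_cast
        ring
      rw [hstep, mul_left_comm] at ih
      have h := mul_add_succ_le_of_le_mul_sub (by positivity) (pow_le_one₀ hν0.le hν1)
        (hP (t + 1)) (Nat.cast_nonneg t) (div_nonneg (hf t) hM.le) ih
        (g' := f (t + 1) / (4 * β ^ 2 * C ^ 2 * lam))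
        (by rw [div_mul_eq_mul_div]; exact div_le_div_of_nonneg_right (hrec t) hM.le)
      simpa only [Nat.cast_succ] using h
  intro t
  constructor
  · have hD : 0 < C ^ 2 * ν ^ (2 - 2 * (t : ℤ)) + t := by have := hP t; positivity
    rw [le_div_iff₀ hD, ← div_le_iff₀' hM, ← div_mul_eq_mul_div]
    exact key t
  · induction t with
    | zero => simpa using hf0
    | succ t ih =>
      calc f (t + 1) ≤ f t * (ν ^ 2 - f t / (4 * β ^ 2 * C ^ 2 * lam)) := hrec t
        _ ≤ f t * ν ^ 2 :=
          mul_le_mul_of_nonneg_left (sub_le_self _ (div_nonneg (hf t) hM.le)) (hf t)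
        _ ≤ 4 * β ^ 2 * lam * ν ^ (2 * t) * ν ^ 2 := by gcongr
        _ = 4 * β ^ 2 * lam * ν ^ (2 * (t + 1)) := by ring
end

section
/- Let A ∈ ℝ^{d×n}, λ ≥ 0 and ρ ≥ 0. Define φ as the infimum over all u ∈ {0,1}ⁿ and X ∈ ℝ^{n×n} of λ·Σ_{j=1}^{n} u_j + ‖A·diag(u)·X − A‖_F² + ρ²‖X‖_F². Then φ ≥ inf over X ∈ ℝ^{n×n} of ‖AX − A‖_F² + 2ρ√λ·Σ_{i=1}^{n} ‖X^{(i)}‖₂, where X^{(i)} denotes the i-th row of X and ‖·‖_F denotes the Frobenius norm. -/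
open Matrix

/-- Squared Frobenius norm of a matrix. -/
def frobNormSq {d n : ℕ} (M : Matrix (Fin d) (Fin n) ℝ) : ℝ :=
  ∑ i, ∑ j, (M i j) ^ 2

theorem sq_rowNorm {n m : ℕ} (X : Matrix (Fin n) (Fin m) ℝ) (i : Fin n) :
    rowNorm X i ^ 2 = ∑ j, X i j ^ 2 :=
  Real.sq_sqrt (Finset.sum_nonneg fun _ _ => sq_nonneg _)

theorem rowNorm_nonneg {n m : ℕ} (X : Matrix (Fin n) (Fin m) ℝ) (i : Fin n) :
    0 ≤ rowNorm X i :=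
  Real.sqrt_nonneg _

theorem frobNormSq_eq_sum_sq_rowNorm {n m : ℕ} (X : Matrix (Fin n) (Fin m) ℝ) :
    frobNormSq X = ∑ i, rowNorm X i ^ 2 := by
  simp only [sq_rowNorm, frobNormSq]

theorem frobNormSq_nonneg {n m : ℕ} (X : Matrix (Fin n) (Fin m) ℝ) : 0 ≤ frobNormSq X :=
  Finset.sum_nonneg fun _ _ => Finset.sum_nonneg fun _ _ => sq_nonneg _

/-- Boolean row selection costs at least the row norm penalty on the selected row. -/
theorem two_mul_sqrt_mul_rowNorm_diagonal_mul_le {n m : ℕ} {lam : ℝ} (hlam : 0 ≤ lam) (ρ : ℝ)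
    (u : Fin n → ℝ) (X : Matrix (Fin n) (Fin m) ℝ) {i : Fin n} (hu : u i = 0 ∨ u i = 1) :
    2 * ρ * Real.sqrt lam * rowNorm (Matrix.diagonal u * X) i ≤
      lam * u i + ρ ^ 2 * rowNorm X i ^ 2 := by
  rcases hu with h | h
  · have h0 : rowNorm (Matrix.diagonal u * X) i = 0 := by
      simp [rowNorm, Matrix.diagonal_mul, h]
    rw [h0, h, mul_zero, mul_zero, zero_add]
    positivity
  · have h1 : rowNorm (Matrix.diagonal u * X) i = rowNorm X i := by
      simp [rowNorm, Matrix.diagonal_mul, h]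
    rw [h1, h]
    nlinarith [sq_nonneg (ρ * rowNorm X i - Real.sqrt lam), Real.sq_sqrt hlam]

/-- The optimal value `φ` of the boolean exemplar selection problem is lower
bounded by the optimal value of its group lasso convex relaxation. -/
theorem boolean_problem_ge_group_lasso_relaxation {d n : ℕ}
    (A : Matrix (Fin d) (Fin n) ℝ) (lam ρ : ℝ) (hlam : 0 ≤ lam) (hρ : 0 ≤ ρ) :
    sInf {v : ℝ | ∃ u : Fin n → ℝ, (∀ j, u j = 0 ∨ u j = 1) ∧
        ∃ X : Matrix (Fin n) (Fin n) ℝ,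
          v = lam * ∑ j, u j
              + frobNormSq (A * Matrix.diagonal u * X - A)
              + ρ ^ 2 * frobNormSq X} ≥
      sInf {v : ℝ | ∃ X : Matrix (Fin n) (Fin n) ℝ,
          v = frobNormSq (A * X - A) + 2 * ρ * Real.sqrt lam * ∑ i, rowNorm X i} := by
  refine le_csInf ⟨_, 0, fun _ => Or.inl rfl, 0, rfl⟩ ?_
  rintro v ⟨u, hu, X, rfl⟩
  refine csInf_le_of_le ⟨0, ?_⟩ ⟨Matrix.diagonal u * X, rfl⟩ ?_
  · rintro v ⟨Y, rfl⟩
    have hY : 0 ≤ ∑ i, rowNorm Y i := Finset.sum_nonneg fun i _ => rowNorm_nonneg Y i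
    have := frobNormSq_nonneg (A * Y - A)
    positivity
  · have hsum := Finset.sum_le_sum fun i (_ : i ∈ Finset.univ) =>
      two_mul_sqrt_mul_rowNorm_diagonal_mul_le hlam ρ u X (hu i)
    rw [Finset.sum_add_distrib, ← Finset.mul_sum, ← Finset.mul_sum, ← Finset.mul_sum,
      ← frobNormSq_eq_sum_sq_rowNorm] at hsum
    rw [← Matrix.mul_assoc]
    linarith
end

section
/- Let B: [0,∞) → ℝ be the reverse Huber function defined by B(x) = x for 0 ≤ x ≤ 1 and B(x) = (x² + 1)/2 for x > 1. Then for all ρ > 0, λ > 0 and t ≥ 0: ρ²t² + λ·(1 if t > 0 else 0) ≥ 2λ·B(ρt/√λ) ≥ 2ρ√λ·t. -/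
/-- The reverse Huber function: `B(x) = x` for `x ≤ 1` and `B(x) = (x² + 1)/2`
for `x > 1`. -/
noncomputable def revHuber (x : ℝ) : ℝ := if x ≤ 1 then x else (x ^ 2 + 1) / 2

theorem le_revHuber (x : ℝ) : x ≤ revHuber x := by
  unfold revHuber
  split_ifs
  · exact le_rfl
  · nlinarith [sq_nonneg (x - 1)]

theorem revHuber_le (x : ℝ) : revHuber x ≤ (x ^ 2 + 1) / 2 := by
  unfold revHuber
  split_ifs
  · nlinarith [sq_nonneg (x - 1)]
  · exact le_rfl

theorem revHuber_zero : revHuber 0 = 0 := by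
  simp [revHuber]

/-- Two-sided relaxation inequality: the boolean sparsity cost
`ρ²t² + λ·1(t > 0)` dominates `2λ·B(ρt/√λ)`, which in turn dominates the group
lasso penalty `2ρ√λ·t`, for all `t ≥ 0`. -/
theorem reverse_huber_relaxation (ρ lam t : ℝ) (hρ : 0 < ρ) (hlam : 0 < lam)
    (ht : 0 ≤ t) :
    ρ ^ 2 * t ^ 2 + lam * (if 0 < t then 1 else 0)
        ≥ 2 * lam * revHuber (ρ * t / Real.sqrt lam) ∧
      2 * lam * revHuber (ρ * t / Real.sqrt lam) ≥ 2 * ρ * Real.sqrt lam * t := by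
  have hs : 0 < Real.sqrt lam := Real.sqrt_pos.2 hlam
  have hsq : Real.sqrt lam ^ 2 = lam := Real.sq_sqrt hlam.le
  constructor
  · rcases ht.eq_or_lt with rfl | htpos
    · simp [revHuber_zero]
    · have hx : lam * (ρ * t / Real.sqrt lam) ^ 2 = ρ ^ 2 * t ^ 2 := by
        rw [div_pow, hsq]
        field_simp
      rw [if_pos htpos]
      nlinarith [mul_le_mul_of_nonneg_left (revHuber_le (ρ * t / Real.sqrt lam)) hlam.le]
  · have hx : lam * (ρ * t / Real.sqrt lam) = ρ * Real.sqrt lam * t := by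
      rw [← mul_div_assoc, div_eq_iff hs.ne']
      linear_combination -(ρ * t) * hsq
    nlinarith [mul_le_mul_of_nonneg_left (le_revHuber (ρ * t / Real.sqrt lam)) hlam.le]
end
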